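/- Correctness of bidirectional checking for CCω: if ⊢ Γ, there exists i such that Γ ⊢ T : □_i, and Γ ⊢ t ◃ T, then Γ ⊢ t : T. -/

import Mathlib

/-! Formalization of CCω (terms, reduction, conversion, undirected and
bidirectional typing, cumulativity) using de Bruijn indices, following
Lennon-Bertrand, "Complete Bidirectional Typing for the Calculus of
Inductive Constructions". -/

namespace CComega

/-- Terms of CCω: `t ::= x | □_i | Πx:t.t | λx:t.t | t t`,
with variables as de Bruijn indices. -/
inductive Tm : Type
  | var : ℕ → Tm
  | sort : ℕ → Tm
  | pi : Tm → Tm → Tm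
  | lam : Tm → Tm → Tm
  | app : Tm → Tm → Tm
deriving DecidableEq

/-- `lift n k t` shifts by `n` the de Bruijn indices of `t` that are ≥ `k`. -/
def lift (n k : ℕ) : Tm → Tm
  | .var i => if i < k then .var i else .var (i + n)
  | .sort i => .sort i
  | .pi A B => .pi (lift n k A) (lift n (k + 1) B)
  | .lam A t => .lam (lift n k A) (lift n (k + 1) t)
  | .app t u => .app (lift n k t) (lift n k u)

/-- `subst u k t` is the capture-avoiding substitution `t[u/k]` of `u`
for de Bruijn index `k` in `t`. -/
def subst (u : Tm) (k : ℕ) : Tm → Tm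
  | .var i => if i < k then .var i else if i = k then lift k 0 u else .var (i - 1)
  | .sort i => .sort i
  | .pi A B => .pi (subst u k A) (subst u (k + 1) B)
  | .lam A t => .lam (subst u k A) (subst u (k + 1) t)
  | .app t v => .app (subst u k t) (subst u k v)

/-- One-step reduction `t → t'`: the least congruence such that
`(λx:A.t) u → t[u/x]`. -/
inductive Red : Tm → Tm → Prop
  | beta (A t u : Tm) : Red (.app (.lam A t) u) (subst u 0 t)
  | piDom {A A'} (B : Tm) : Red A A' → Red (.pi A B) (.pi A' B)
  | piCod (A : Tm) {B B'} : Red B B' → Red (.pi A B) (.pi A B')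
  | lamDom {A A'} (t : Tm) : Red A A' → Red (.lam A t) (.lam A' t)
  | lamBody (A : Tm) {t t'} : Red t t' → Red (.lam A t) (.lam A t')
  | appFun {t t'} (u : Tm) : Red t t' → Red (.app t u) (.app t' u)
  | appArg (t : Tm) {u u'} : Red u u' → Red (.app t u) (.app t u')

/-- Multi-step reduction `t ↠ t'`: reflexive-transitive closure of `→`. -/
def Reds : Tm → Tm → Prop := Relation.ReflTransGen Red

/-- Conversion `t ≡ u`: symmetric, reflexive, transitive closure of `→`. -/
def Conv : Tm → Tm → Prop := Relation.EqvGen Red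

/-- Contexts are lists of (de Bruijn) declarations, most recent first. -/
abbrev Ctx := List Tm

mutual
/-- Context well-formedness `⊢ Γ`. -/
inductive WfCtx : Ctx → Prop
  | nil : WfCtx []
  | cons {Γ A i} : WfCtx Γ → Typed Γ A (.sort i) → WfCtx (A :: Γ)

/-- Undirected typing `Γ ⊢ t : T`. -/
inductive Typed : Ctx → Tm → Tm → Prop
  | sort {Γ i} : WfCtx Γ → Typed Γ (.sort i) (.sort (i + 1))
  | var {Γ n A} : WfCtx Γ → Γ[n]? = some A → Typed Γ (.var n) (lift (n + 1) 0 A)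
  | pi {Γ A B i j} : Typed Γ A (.sort i) → Typed (A :: Γ) B (.sort j) →
      Typed Γ (.pi A B) (.sort (max i j))
  | lam {Γ A B t i} : Typed Γ (.pi A B) (.sort i) → Typed (A :: Γ) t B →
      Typed Γ (.lam A t) (.pi A B)
  | app {Γ t u A B} : Typed Γ t (.pi A B) → Typed Γ u A →
      Typed Γ (.app t u) (subst u 0 B)
  | conv {Γ t A B i} : Typed Γ t A → Typed Γ B (.sort i) → Conv A B →
      Typed Γ t B
end

mutual
/-- Bidirectional inference `Γ ⊢ t ▹ T`. -/
inductive Infer : Ctx → Tm → Tm → Prop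
  | sort {Γ i} : Infer Γ (.sort i) (.sort (i + 1))
  | var {Γ n A} : Γ[n]? = some A → Infer Γ (.var n) (lift (n + 1) 0 A)
  | pi {Γ A B i j} : InferSort Γ A (.sort i) → InferSort (A :: Γ) B (.sort j) →
      Infer Γ (.pi A B) (.sort (max i j))
  | lam {Γ A t B i} : InferSort Γ A (.sort i) → Infer (A :: Γ) t B →
      Infer Γ (.lam A t) (.pi A B)
  | app {Γ t u A B} : InferPi Γ t (.pi A B) → Check Γ u A →
      Infer Γ (.app t u) (subst u 0 B)

/-- Bidirectional checking `Γ ⊢ t ◃ T`. -/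
inductive Check : Ctx → Tm → Tm → Prop
  | check {Γ t T T'} : Infer Γ t T' → Conv T' T → Check Γ t T

/-- Constrained inference `Γ ⊢ t ▹_□ T` (the output is a universe). -/
inductive InferSort : Ctx → Tm → Tm → Prop
  | inferSort {Γ t T i} : Infer Γ t T → Reds T (.sort i) → InferSort Γ t (.sort i)

/-- Constrained inference `Γ ⊢ t ▹_Π T` (the output is a product type). -/
inductive InferPi : Ctx → Tm → Tm → Prop
  | inferPi {Γ t T A B} : Infer Γ t T → Reds T (.pi A B) → InferPi Γ t (.pi A B)
end

/-- Weak-head reduction `t ⇝ t'`: reduction only at the head. -/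
inductive WhRed : Tm → Tm → Prop
  | beta (A t u : Tm) : WhRed (.app (.lam A t) u) (subst u 0 t)
  | appFun {t t'} (u : Tm) : WhRed t t' → WhRed (.app t u) (.app t' u)

/-- Multi-step weak-head reduction `t ⇝* t'`. -/
def WhReds : Tm → Tm → Prop := Relation.ReflTransGen WhRed

mutual
/-- Weak-head bidirectional inference: as `Infer`, but constrained inference
uses weak-head reduction. -/
inductive InferW : Ctx → Tm → Tm → Prop
  | sort {Γ i} : InferW Γ (.sort i) (.sort (i + 1))
  | var {Γ n A} : Γ[n]? = some A → InferW Γ (.var n) (lift (n + 1) 0 A)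
  | pi {Γ A B i j} : InferSortW Γ A (.sort i) → InferSortW (A :: Γ) B (.sort j) →
      InferW Γ (.pi A B) (.sort (max i j))
  | lam {Γ A t B i} : InferSortW Γ A (.sort i) → InferW (A :: Γ) t B →
      InferW Γ (.lam A t) (.pi A B)
  | app {Γ t u A B} : InferPiW Γ t (.pi A B) → CheckW Γ u A →
      InferW Γ (.app t u) (subst u 0 B)

/-- Weak-head bidirectional checking. -/
inductive CheckW : Ctx → Tm → Tm → Prop
  | check {Γ t T T'} : InferW Γ t T' → Conv T' T → CheckW Γ t T

/-- Weak-head constrained inference `Γ ⊢ t ▹_□ T`. -/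
inductive InferSortW : Ctx → Tm → Tm → Prop
  | inferSort {Γ t T i} : InferW Γ t T → WhReds T (.sort i) →
      InferSortW Γ t (.sort i)

/-- Weak-head constrained inference `Γ ⊢ t ▹_Π T`. -/
inductive InferPiW : Ctx → Tm → Tm → Prop
  | inferPi {Γ t T A B} : InferW Γ t T → WhReds T (.pi A B) →
      InferPiW Γ t (.pi A B)
end

/-- Cumulativity `t ≼ u`: the least transitive relation containing conversion
such that `□_i ≼ □_j` whenever `i ≤ j` and `Πx:A.B ≼ Πx:A'.B'` whenever
`A ≡ A'` and `B ≼ B'`. -/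
inductive Cum : Tm → Tm → Prop
  | ofConv {t u} : Conv t u → Cum t u
  | sort {i j : ℕ} : i ≤ j → Cum (.sort i) (.sort j)
  | pi {A A' B B'} : Conv A A' → Cum B B' → Cum (.pi A B) (.pi A' B')
  | trans {t u v} : Cum t u → Cum u v → Cum t v

mutual
/-- Context well-formedness for the cumulative undirected system. -/
inductive WfCtxC : Ctx → Prop
  | nil : WfCtxC []
  | cons {Γ A i} : WfCtxC Γ → TypedC Γ A (.sort i) → WfCtxC (A :: Γ)

/-- Cumulative undirected typing `Γ ⊢ t : T`: as `Typed`, with the conversion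
rule replaced by cumulativity. -/
inductive TypedC : Ctx → Tm → Tm → Prop
  | sort {Γ i} : WfCtxC Γ → TypedC Γ (.sort i) (.sort (i + 1))
  | var {Γ n A} : WfCtxC Γ → Γ[n]? = some A → TypedC Γ (.var n) (lift (n + 1) 0 A)
  | pi {Γ A B i j} : TypedC Γ A (.sort i) → TypedC (A :: Γ) B (.sort j) →
      TypedC Γ (.pi A B) (.sort (max i j))
  | lam {Γ A B t i} : TypedC Γ (.pi A B) (.sort i) → TypedC (A :: Γ) t B →
      TypedC Γ (.lam A t) (.pi A B)
  | app {Γ t u A B} : TypedC Γ t (.pi A B) → TypedC Γ u A →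
      TypedC Γ (.app t u) (subst u 0 B)
  | cumul {Γ t A B i} : TypedC Γ t A → TypedC Γ B (.sort i) → Cum A B →
      TypedC Γ t B
end

mutual
/-- Cumulative bidirectional inference `Γ ⊢ t ▹ T`. -/
inductive InferC : Ctx → Tm → Tm → Prop
  | sort {Γ i} : InferC Γ (.sort i) (.sort (i + 1))
  | var {Γ n A} : Γ[n]? = some A → InferC Γ (.var n) (lift (n + 1) 0 A)
  | pi {Γ A B i j} : InferSortC Γ A (.sort i) → InferSortC (A :: Γ) B (.sort j) →
      InferC Γ (.pi A B) (.sort (max i j))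
  | lam {Γ A t B i} : InferSortC Γ A (.sort i) → InferC (A :: Γ) t B →
      InferC Γ (.lam A t) (.pi A B)
  | app {Γ t u A B} : InferPiC Γ t (.pi A B) → CheckC Γ u A →
      InferC Γ (.app t u) (subst u 0 B)

/-- Cumulative bidirectional checking `Γ ⊢ t ◃ T`, using cumulativity. -/
inductive CheckC : Ctx → Tm → Tm → Prop
  | check {Γ t T T'} : InferC Γ t T' → Cum T' T → CheckC Γ t T

/-- Cumulative constrained inference `Γ ⊢ t ▹_□ T` (unchanged: uses reduction). -/
inductive InferSortC : Ctx → Tm → Tm → Prop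
  | inferSort {Γ t T i} : InferC Γ t T → Reds T (.sort i) → InferSortC Γ t (.sort i)

/-- Cumulative constrained inference `Γ ⊢ t ▹_Π T` (unchanged: uses reduction). -/
inductive InferPiC : Ctx → Tm → Tm → Prop
  | inferPi {Γ t T A B} : InferC Γ t T → Reds T (.pi A B) → InferPiC Γ t (.pi A B)
end

/-! ### Parallel renamings and substitutions -/

/-- Extend a renaming under a binder. -/
def upRen (ξ : ℕ → ℕ) : ℕ → ℕ
  | 0 => 0
  | n + 1 => ξ n + 1

/-- Parallel renaming. -/
def ren (ξ : ℕ → ℕ) : Tm → Tm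
  | .var i => .var (ξ i)
  | .sort i => .sort i
  | .pi A B => .pi (ren ξ A) (ren (upRen ξ) B)
  | .lam A t => .lam (ren ξ A) (ren (upRen ξ) t)
  | .app t u => .app (ren ξ t) (ren ξ u)

/-- Extend a substitution under a binder. -/
def upSub (σ : ℕ → Tm) : ℕ → Tm
  | 0 => .var 0
  | n + 1 => ren Nat.succ (σ n)

/-- Parallel substitution. -/
def psub (σ : ℕ → Tm) : Tm → Tm
  | .var i => σ i
  | .sort i => .sort i
  | .pi A B => .pi (psub σ A) (psub (upSub σ) B)
  | .lam A t => .lam (psub σ A) (psub (upSub σ) t)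
  | .app t u => .app (psub σ t) (psub σ u)

/-- The substitution of `u` for the most recent variable. -/
def inst (u : Tm) : ℕ → Tm
  | 0 => u
  | n + 1 => .var n

theorem upRen_comp (ξ ζ : ℕ → ℕ) : upRen ξ ∘ upRen ζ = upRen (ξ ∘ ζ) := by
  funext n; cases n <;> rfl

theorem ren_ren (t : Tm) : ∀ ξ ζ : ℕ → ℕ, ren ξ (ren ζ t) = ren (ξ ∘ ζ) t := by
  induction t <;> intro ξ ζ <;> simp_all [ren, upRen_comp]

theorem upSub_comp_upRen (σ : ℕ → Tm) (ξ : ℕ → ℕ) :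
    upSub σ ∘ upRen ξ = upSub (σ ∘ ξ) := by
  funext n; cases n <;> rfl

theorem psub_ren (t : Tm) : ∀ (σ : ℕ → Tm) (ξ : ℕ → ℕ),
    psub σ (ren ξ t) = psub (σ ∘ ξ) t := by
  induction t <;> intro σ ξ <;> simp_all [ren, psub, upSub_comp_upRen]

theorem ren_comp_upSub (ξ : ℕ → ℕ) (σ : ℕ → Tm) :
    ren (upRen ξ) ∘ upSub σ = upSub (ren ξ ∘ σ) := by
  funext n
  cases n with
  | zero => rfl
  | succ n => simp only [Function.comp, upSub, ren_ren]; rfl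

theorem ren_psub (t : Tm) : ∀ (ξ : ℕ → ℕ) (σ : ℕ → Tm),
    ren ξ (psub σ t) = psub (ren ξ ∘ σ) t := by
  induction t <;> intro ξ σ <;> simp_all [ren, psub, ren_comp_upSub]

theorem psub_comp_upSub (σ τ : ℕ → Tm) :
    psub (upSub σ) ∘ upSub τ = upSub (psub σ ∘ τ) := by
  funext n
  cases n with
  | zero => rfl
  | succ n => simp only [Function.comp, upSub, psub_ren, ren_psub]; rfl

theorem psub_psub (t : Tm) : ∀ σ τ : ℕ → Tm,
    psub σ (psub τ t) = psub (psub σ ∘ τ) t := by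
  induction t <;> intro σ τ <;> simp_all [psub, psub_comp_upSub]

theorem upSub_var_comp (ξ : ℕ → ℕ) : upSub (Tm.var ∘ ξ) = Tm.var ∘ upRen ξ := by
  funext n; cases n <;> rfl

theorem ren_eq_psub (t : Tm) : ∀ ξ : ℕ → ℕ, ren ξ t = psub (Tm.var ∘ ξ) t := by
  induction t <;> intro ξ <;> simp_all [ren, psub, upSub_var_comp]

theorem upSub_var : upSub Tm.var = Tm.var := by
  funext n; cases n <;> rfl

theorem psub_var (t : Tm) : psub Tm.var t = t := by
  induction t <;> simp_all [psub, upSub_var]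

theorem upRen_iterate (n k i : ℕ) :
    upRen^[k] (· + n) i = if i < k then i else i + n := by
  induction k generalizing i with
  | zero => simp
  | succ k ih =>
    rw [Function.iterate_succ_apply']
    cases i with
    | zero => simp [upRen]
    | succ i => simp only [upRen, ih]; split_ifs <;> omega

theorem lift_eq_ren_iterate (n : ℕ) (t : Tm) :
    ∀ k, lift n k t = ren (upRen^[k] (· + n)) t := by
  induction t <;> intro k <;>
    simp_all [lift, ren, upRen_iterate, Function.iterate_succ_apply']
  split_ifs <;> rfl

theorem lift_eq_ren (n : ℕ) (t : Tm) : lift n 0 t = ren (· + n) t :=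
  lift_eq_ren_iterate n t 0

theorem upSub_iterate_inst (u : Tm) (k i : ℕ) :
    upSub^[k] (inst u) i =
      if i < k then .var i else if i = k then lift k 0 u else .var (i - 1) := by
  induction k generalizing i with
  | zero =>
    cases i with
    | zero => simp [inst, lift_eq_ren, ren_eq_psub, Function.comp_def, psub_var]
    | succ i => simp [inst]
  | succ k ih =>
    rw [Function.iterate_succ_apply']
    cases i with
    | zero => simp [upSub]
    | succ i =>
      simp only [upSub, ih, Nat.add_lt_add_iff_right, Nat.add_right_cancel_iff]
      split_ifs with h₁ h₂
      · rfl
      · simp only [lift_eq_ren, ren_ren]; rfl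
      · simp only [ren, Tm.var.injEq]; omega

theorem subst_eq_psub_iterate (u : Tm) (t : Tm) :
    ∀ k, subst u k t = psub (upSub^[k] (inst u)) t := by
  induction t <;> intro k <;>
    simp_all [subst, psub, upSub_iterate_inst, Function.iterate_succ_apply']

theorem subst_eq_psub (u t : Tm) : subst u 0 t = psub (inst u) t :=
  subst_eq_psub_iterate u t 0

theorem psub_inst_ren_succ (u t : Tm) : psub (inst u) (ren Nat.succ t) = t := by
  rw [psub_ren]
  exact psub_var t

theorem psub_subst (σ : ℕ → Tm) (u t : Tm) :
    psub σ (subst u 0 t) = subst (psub σ u) 0 (psub (upSub σ) t) := by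
  simp only [subst_eq_psub, psub_psub]
  congr 1
  funext n
  cases n with
  | zero => rfl
  | succ n => simp only [Function.comp, upSub, psub_inst_ren_succ]; rfl

theorem ren_subst (ξ : ℕ → ℕ) (u t : Tm) :
    ren ξ (subst u 0 t) = subst (ren ξ u) 0 (ren (upRen ξ) t) := by
  simp only [ren_eq_psub, psub_subst, upSub_var_comp]

/-! ### Parallel reduction and confluence -/

/-- Parallel reduction. -/
inductive Par : Tm → Tm → Prop
  | var (i : ℕ) : Par (.var i) (.var i)
  | sort (i : ℕ) : Par (.sort i) (.sort i)
  | pi {A A' B B'} : Par A A' → Par B B' → Par (.pi A B) (.pi A' B')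
  | lam {A A' t t'} : Par A A' → Par t t' → Par (.lam A t) (.lam A' t')
  | app {t t' u u'} : Par t t' → Par u u' → Par (.app t u) (.app t' u')
  | beta (A : Tm) {t t' u u'} : Par t t' → Par u u' →
      Par (.app (.lam A t) u) (subst u' 0 t')

theorem Par.refl (t : Tm) : Par t t := by
  induction t <;> constructor <;> assumption

theorem Par.ren {t t' : Tm} (h : Par t t') (ξ : ℕ → ℕ) :
    Par (CComega.ren ξ t) (CComega.ren ξ t') := by
  induction h generalizing ξ with
  | var i => exact .refl _
  | sort i => exact .refl _
  | pi _ _ ih₁ ih₂ => exact .pi (ih₁ _) (ih₂ _)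
  | lam _ _ ih₁ ih₂ => exact .lam (ih₁ _) (ih₂ _)
  | app _ _ ih₁ ih₂ => exact .app (ih₁ _) (ih₂ _)
  | beta A _ _ ih₁ ih₂ =>
    rw [ren_subst]
    exact .beta _ (ih₁ _) (ih₂ _)

theorem Par.upSub {σ τ : ℕ → Tm} (h : ∀ n, Par (σ n) (τ n)) (n : ℕ) :
    Par (CComega.upSub σ n) (CComega.upSub τ n) := by
  cases n with
  | zero => exact .refl _
  | succ n => exact (h n).ren _

theorem Par.psub {t t' : Tm} (h : Par t t') {σ τ : ℕ → Tm}
    (hσ : ∀ n, Par (σ n) (τ n)) : Par (CComega.psub σ t) (CComega.psub τ t') := by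
  induction h generalizing σ τ with
  | var i => exact hσ i
  | sort i => exact .refl _
  | pi _ _ ih₁ ih₂ => exact .pi (ih₁ hσ) (ih₂ (Par.upSub hσ))
  | lam _ _ ih₁ ih₂ => exact .lam (ih₁ hσ) (ih₂ (Par.upSub hσ))
  | app _ _ ih₁ ih₂ => exact .app (ih₁ hσ) (ih₂ hσ)
  | beta A _ _ ih₁ ih₂ =>
    rw [psub_subst]
    exact .beta _ (ih₁ (Par.upSub hσ)) (ih₂ hσ)

theorem Par.subst {t t' u u' : Tm} (ht : Par t t') (hu : Par u u') :
    Par (CComega.subst u 0 t) (CComega.subst u' 0 t') := by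
  simp only [subst_eq_psub]
  refine ht.psub fun n => ?_
  cases n with
  | zero => exact hu
  | succ n => exact .refl _

/-- Complete development: contract all redexes of a term simultaneously. -/
def dev : Tm → Tm
  | .var i => .var i
  | .sort i => .sort i
  | .pi A B => .pi (dev A) (dev B)
  | .lam A t => .lam (dev A) (dev t)
  | .app (.lam _ t) u => subst (dev u) 0 (dev t)
  | .app t u => .app (dev t) (dev u)

theorem Par.dev {t t' : Tm} (h : Par t t') : Par t' (CComega.dev t) := by
  induction h with
  | var i => exact .refl _
  | sort i => exact .refl _
  | pi _ _ ih₁ ih₂ => exact .pi ih₁ ih₂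
  | lam _ _ ih₁ ih₂ => exact .lam ih₁ ih₂
  | @app t t' u u' h₁ h₂ ih₁ ih₂ =>
    cases t with
    | lam A t =>
      cases h₁
      cases ih₁ with
      | lam hA ht => exact .beta _ ht ih₂
    | _ => exact .app ih₁ ih₂
  | beta A _ _ ih₁ ih₂ => exact ih₁.subst ih₂

theorem Red.par {t t' : Tm} (h : Red t t') : Par t t' := by
  induction h with
  | beta A t u => exact .beta A (.refl t) (.refl u)
  | piDom B _ ih => exact .pi ih (.refl _)
  | piCod A _ ih => exact .pi (.refl _) ih
  | lamDom t _ ih => exact .lam ih (.refl _)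
  | lamBody A _ ih => exact .lam (.refl _) ih
  | appFun u _ ih => exact .app ih (.refl _)
  | appArg t _ ih => exact .app (.refl _) ih

theorem Reds.pi {A A' B B' : Tm} (hA : Reds A A') (hB : Reds B B') :
    Reds (.pi A B) (.pi A' B') :=
  (hA.lift (fun A => Tm.pi A B) fun _ _ => Red.piDom B).trans
    (hB.lift (Tm.pi A') fun _ _ => Red.piCod A')

theorem Reds.lam {A A' t t' : Tm} (hA : Reds A A') (ht : Reds t t') :
    Reds (.lam A t) (.lam A' t') :=
  (hA.lift (fun A => Tm.lam A t) fun _ _ => Red.lamDom t).trans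
    (ht.lift (Tm.lam A') fun _ _ => Red.lamBody A')

theorem Reds.app {t t' u u' : Tm} (ht : Reds t t') (hu : Reds u u') :
    Reds (.app t u) (.app t' u') :=
  (ht.lift (fun t => Tm.app t u) fun _ _ => Red.appFun u).trans
    (hu.lift (Tm.app t') fun _ _ => Red.appArg t')

theorem Par.reds {t t' : Tm} (h : Par t t') : Reds t t' := by
  induction h with
  | var i => exact .refl
  | sort i => exact .refl
  | pi _ _ ih₁ ih₂ => exact ih₁.pi ih₂
  | lam _ _ ih₁ ih₂ => exact ih₁.lam ih₂
  | app _ _ ih₁ ih₂ => exact ih₁.app ih₂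
  | beta A _ _ ih₁ ih₂ =>
    exact (Reds.app (Reds.lam (A := A) .refl ih₁) ih₂).tail (.beta _ _ _)

theorem reflTransGen_par : Relation.ReflTransGen Par = Reds := by
  funext t u
  refine propext ⟨fun h => ?_, fun h => Relation.ReflTransGen.mono (fun _ _ => Red.par) _ _ h⟩
  induction h with
  | refl => exact .refl
  | tail _ h ih => exact ih.trans h.reds

/-- Confluence of reduction. -/
theorem Reds.join {t u v : Tm} (hu : Reds t u) (hv : Reds t v) :
    Relation.Join Reds u v := by
  rw [← reflTransGen_par] at *
  exact Relation.church_rosser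
    (fun _ _ _ h₁ h₂ => ⟨_, .single h₁.dev, .single h₂.dev⟩) hu hv

theorem Reds.conv {t u : Tm} (h : Reds t u) : Conv t u := by
  induction h with
  | refl => exact .refl _
  | tail _ h ih => exact ih.trans _ _ _ (.rel _ _ h)

theorem Conv.join {t u : Tm} (h : Conv t u) : Relation.Join Reds t u := by
  induction h with
  | rel _ u h => exact ⟨u, .single h, .refl⟩
  | refl t => exact ⟨t, .refl, .refl⟩
  | symm _ _ _ ih =>
    obtain ⟨w, h₁, h₂⟩ := ih
    exact ⟨w, h₂, h₁⟩
  | trans _ _ _ _ _ ih₁ ih₂ =>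
    obtain ⟨w₁, h₁, h₂⟩ := ih₁
    obtain ⟨w₂, h₃, h₄⟩ := ih₂
    obtain ⟨w, h₅, h₆⟩ := Reds.join h₂ h₃
    exact ⟨w, h₁.trans h₅, h₄.trans h₆⟩

theorem Reds.pi_inv {A B t : Tm} (h : Reds (.pi A B) t) :
    ∃ A' B', t = .pi A' B' ∧ Reds A A' ∧ Reds B B' := by
  induction h with
  | refl => exact ⟨A, B, rfl, .refl, .refl⟩
  | tail _ h ih =>
    obtain ⟨A', B', rfl, hA, hB⟩ := ih
    cases h with
    | piDom _ h => exact ⟨_, _, rfl, hA.tail h, hB⟩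
    | piCod _ h => exact ⟨_, _, rfl, hA, hB.tail h⟩

/-- Injectivity of product types up to conversion. -/
theorem Conv.pi_inj {A A' B B' : Tm} (h : Conv (.pi A B) (.pi A' B')) :
    Conv A A' ∧ Conv B B' := by
  obtain ⟨w, h₁, h₂⟩ := h.join
  obtain ⟨A₁, B₁, rfl, hA₁, hB₁⟩ := h₁.pi_inv
  obtain ⟨A₂, B₂, h_eq, hA₂, hB₂⟩ := h₂.pi_inv
  cases h_eq
  exact ⟨hA₁.conv.trans _ _ _ (hA₂.conv.symm _ _),
    hB₁.conv.trans _ _ _ (hB₂.conv.symm _ _)⟩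

theorem Conv.psub {t u : Tm} (h : Conv t u) (σ : ℕ → Tm) :
    Conv (CComega.psub σ t) (CComega.psub σ u) := by
  induction h with
  | rel _ _ h => exact (h.par.psub fun n => Par.refl (σ n)).reds.conv
  | refl t => exact .refl _
  | symm _ _ _ ih => exact ih.symm _ _
  | trans _ _ _ _ _ ih₁ ih₂ => exact ih₁.trans _ _ _ ih₂

theorem Conv.ren {t u : Tm} (h : Conv t u) (ξ : ℕ → ℕ) :
    Conv (CComega.ren ξ t) (CComega.ren ξ u) := by
  simp only [ren_eq_psub]
  exact h.psub _

theorem Conv.subst {t u : Tm} (h : Conv t u) (v : Tm) :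
    Conv (CComega.subst v 0 t) (CComega.subst v 0 u) := by
  simp only [subst_eq_psub]
  exact h.psub _

/-! ### Metatheory of undirected typing -/

/-- Induction on typing derivations, ignoring the context well-formedness part. -/
@[elab_as_elim]
theorem Typed.ind {motive : ∀ Γ t T, Typed Γ t T → Prop}
    (sort : ∀ {Γ i} (h : WfCtx Γ), motive Γ (.sort i) (.sort (i + 1)) (.sort h))
    (var : ∀ {Γ n A} (h : WfCtx Γ) (h_get : Γ[n]? = some A),
      motive Γ (.var n) (lift (n + 1) 0 A) (.var h h_get))
    (pi : ∀ {Γ A B i j} (hA : Typed Γ A (.sort i)) (hB : Typed (A :: Γ) B (.sort j)),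
      motive Γ A (.sort i) hA → motive (A :: Γ) B (.sort j) hB →
      motive Γ (.pi A B) (.sort (max i j)) (.pi hA hB))
    (lam : ∀ {Γ A B t i} (hP : Typed Γ (.pi A B) (.sort i)) (ht : Typed (A :: Γ) t B),
      motive Γ (.pi A B) (.sort i) hP → motive (A :: Γ) t B ht →
      motive Γ (.lam A t) (.pi A B) (.lam hP ht))
    (app : ∀ {Γ t u A B} (ht : Typed Γ t (.pi A B)) (hu : Typed Γ u A),
      motive Γ t (.pi A B) ht → motive Γ u A hu →
      motive Γ (.app t u) (subst u 0 B) (.app ht hu))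
    (conv : ∀ {Γ t A B i} (ht : Typed Γ t A) (hB : Typed Γ B (.sort i)) (hc : Conv A B),
      motive Γ t A ht → motive Γ B (.sort i) hB → motive Γ t B (.conv ht hB hc))
    {Γ : Ctx} {t T : Tm} (h : Typed Γ t T) : motive Γ t T h :=
  Typed.rec (motive_1 := fun _ _ => True) (motive_2 := motive)
    trivial (fun _ _ _ _ => trivial) (fun h _ => sort h) (fun h h_get _ => var h h_get)
    pi lam app conv h

theorem Typed.wf {Γ : Ctx} {t T : Tm} (h : Typed Γ t T) : WfCtx Γ := by
  induction h using Typed.ind <;> assumption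

theorem Typed.pi_inv {Γ : Ctx} {A B T : Tm} (h : Typed Γ (.pi A B) T) :
    (∃ i, Typed Γ A (.sort i)) ∧ ∃ j, Typed (A :: Γ) B (.sort j) := by
  generalize h_eq : Tm.pi A B = t at h
  induction h using Typed.ind with
  | pi hA hB _ _ => cases h_eq; exact ⟨⟨_, hA⟩, _, hB⟩
  | conv _ _ _ ih _ => exact ih h_eq
  | _ => cases h_eq

theorem Typed.lam_inv {Γ : Ctx} {A t T : Tm} (h : Typed Γ (.lam A t) T) :
    ∃ B, Typed (A :: Γ) t B ∧ (∃ i, Typed Γ (.pi A B) (.sort i)) ∧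
      Conv (.pi A B) T := by
  generalize h_eq : Tm.lam A t = s at h
  induction h using Typed.ind with
  | lam hP ht _ _ => cases h_eq; exact ⟨_, ht, ⟨_, hP⟩, .refl _⟩
  | conv _ _ hc ih _ =>
    obtain ⟨B, ht, hP, hB⟩ := ih h_eq
    exact ⟨B, ht, hP, hB.trans _ _ _ hc⟩
  | _ => cases h_eq

/-- `ξ` is a well-typed renaming from `Γ` to `Δ`. -/
def RenTyped (Γ Δ : Ctx) (ξ : ℕ → ℕ) : Prop :=
  ∀ n A, Γ[n]? = some A →
    ∃ A', Δ[ξ n]? = some A' ∧ lift (ξ n + 1) 0 A' = ren ξ (lift (n + 1) 0 A)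

theorem ren_lift_succ {ξ ζ : ℕ → ℕ} (h : ∀ n, ξ (n + 1) = ζ n + 1) (n : ℕ) (A : Tm) :
    ren ξ (lift (n + 1) 0 A) = ren Nat.succ (ren ζ (lift n 0 A)) := by
  simp only [lift_eq_ren, ren_ren]
  congr 1
  funext m
  exact h (m + n)

theorem lift_succ_eq_ren (n : ℕ) (A : Tm) : lift (n + 1) 0 A = ren Nat.succ (lift n 0 A) := by
  simp only [lift_eq_ren, ren_ren]; rfl

theorem lift_zero (A : Tm) : lift 0 0 A = A := by
  simp only [lift_eq_ren, ren_eq_psub]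
  exact psub_var A

theorem RenTyped.up {Γ Δ : Ctx} {ξ : ℕ → ℕ} (h : RenTyped Γ Δ ξ) (A : Tm) :
    RenTyped (A :: Γ) (ren ξ A :: Δ) (upRen ξ) := by
  intro n B hB
  rw [ren_lift_succ (ζ := ξ) fun _ => rfl]
  cases n with
  | zero =>
    cases hB
    exact ⟨_, rfl, by rw [lift_zero, lift_succ_eq_ren]; exact congrArg _ (lift_zero _)⟩
  | succ n =>
    obtain ⟨B', h₁, h₂⟩ := h n B hB
    exact ⟨B', h₁, by rw [lift_succ_eq_ren]; exact congrArg _ h₂⟩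

theorem Typed.ren {Γ : Ctx} {t T : Tm} (h : Typed Γ t T) {Δ : Ctx} {ξ : ℕ → ℕ}
    (hΔ : WfCtx Δ) (hξ : RenTyped Γ Δ ξ) :
    Typed Δ (CComega.ren ξ t) (CComega.ren ξ T) := by
  induction h using Typed.ind generalizing Δ ξ with
  | sort _ => exact .sort hΔ
  | var _ h_get =>
    obtain ⟨A', h₁, h₂⟩ := hξ _ _ h_get
    rw [← h₂]
    exact .var hΔ h₁
  | pi _ _ ih₁ ih₂ =>
    have hA := ih₁ hΔ hξ
    exact .pi hA (ih₂ (.cons hΔ hA) (hξ.up _))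
  | lam _ _ ih₁ ih₂ =>
    have hP := ih₁ hΔ hξ
    obtain ⟨⟨_, hA⟩, _⟩ := hP.pi_inv
    exact .lam hP (ih₂ (.cons hΔ hA) (hξ.up _))
  | app _ _ ih₁ ih₂ =>
    rw [ren_subst]
    exact .app (ih₁ hΔ hξ) (ih₂ hΔ hξ)
  | conv _ _ hc ih₁ ih₂ => exact .conv (ih₁ hΔ hξ) (ih₂ hΔ hξ) (hc.ren ξ)

/-- Weakening by one declaration. -/
theorem Typed.weaken {Γ : Ctx} {t T A : Tm} (h : Typed Γ t T) (hA : WfCtx (A :: Γ)) :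
    Typed (A :: Γ) (CComega.ren Nat.succ t) (CComega.ren Nat.succ T) :=
  h.ren hA fun n B hB => ⟨B, hB, lift_succ_eq_ren (n + 1) B⟩

/-- `σ` is a well-typed substitution from `Γ` to `Δ`. -/
def SubTyped (Γ Δ : Ctx) (σ : ℕ → Tm) : Prop :=
  ∀ n A, Γ[n]? = some A → Typed Δ (σ n) (psub σ (lift (n + 1) 0 A))

theorem psub_lift_succ {σ τ : ℕ → Tm} (h : ∀ n, σ (n + 1) = ren Nat.succ (τ n))
    (n : ℕ) (A : Tm) :
    psub σ (lift (n + 1) 0 A) = ren Nat.succ (psub τ (lift n 0 A)) := by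
  rw [lift_succ_eq_ren, psub_ren, ren_psub]
  congr 1
  funext m
  exact h m

theorem SubTyped.up {Γ Δ : Ctx} {σ : ℕ → Tm} (h : SubTyped Γ Δ σ) {A : Tm}
    (hA : WfCtx (psub σ A :: Δ)) : SubTyped (A :: Γ) (psub σ A :: Δ) (upSub σ) := by
  intro n B hB
  rw [psub_lift_succ (τ := σ) fun _ => rfl]
  cases n with
  | zero =>
    cases hB
    have h_var := Typed.var (n := 0) hA rfl
    rw [lift_succ_eq_ren, lift_zero] at h_var
    rwa [lift_zero]
  | succ n => exact (h n B hB).weaken hA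

theorem Typed.psub {Γ : Ctx} {t T : Tm} (h : Typed Γ t T) {Δ : Ctx} {σ : ℕ → Tm}
    (hΔ : WfCtx Δ) (hσ : SubTyped Γ Δ σ) :
    Typed Δ (CComega.psub σ t) (CComega.psub σ T) := by
  induction h using Typed.ind generalizing Δ σ with
  | sort _ => exact .sort hΔ
  | var _ h_get => exact hσ _ _ h_get
  | pi _ _ ih₁ ih₂ =>
    have hA := ih₁ hΔ hσ
    exact .pi hA (ih₂ (.cons hΔ hA) (hσ.up (.cons hΔ hA)))
  | lam _ _ ih₁ ih₂ =>
    have hP := ih₁ hΔ hσ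
    obtain ⟨⟨_, hA⟩, _⟩ := hP.pi_inv
    exact .lam hP (ih₂ (.cons hΔ hA) (hσ.up (.cons hΔ hA)))
  | app _ _ ih₁ ih₂ =>
    rw [psub_subst]
    exact .app (ih₁ hΔ hσ) (ih₂ hΔ hσ)
  | conv _ _ hc ih₁ ih₂ => exact .conv (ih₁ hΔ hσ) (ih₂ hΔ hσ) (hc.psub σ)

theorem Typed.subst {Γ : Ctx} {t T u A : Tm} (h : Typed (A :: Γ) t T)
    (hu : Typed Γ u A) : Typed Γ (CComega.subst u 0 t) (CComega.subst u 0 T) := by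
  simp only [subst_eq_psub]
  refine h.psub hu.wf fun n B hB => ?_
  rw [lift_succ_eq_ren, psub_inst_ren_succ]
  cases n with
  | zero =>
    cases hB
    rwa [lift_zero]
  | succ n => exact .var hu.wf hB

/-- Replacing the last declaration of a context by a convertible one. -/
theorem Typed.conv_ctx {Γ : Ctx} {t T A A' : Tm} (h : Typed (A :: Γ) t T) {i j : ℕ}
    (hA : Typed Γ A (.sort i)) (hA' : Typed Γ A' (.sort j)) (hc : Conv A' A) :
    Typed (A' :: Γ) t T := by
  have h_wf : WfCtx (A' :: Γ) := .cons hA.wf hA'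
  have h_sub := h.psub (σ := Tm.var) h_wf fun n B hB => by
    rw [psub_var]
    cases n with
    | zero =>
      cases hB
      have h_var := Typed.var (n := 0) h_wf rfl
      rw [lift_succ_eq_ren, lift_zero] at h_var ⊢
      exact h_var.conv (hA.weaken h_wf) (hc.ren _)
    | succ n => exact .var h_wf hB
  rwa [psub_var, psub_var] at h_sub

theorem WfCtx.lookup {Γ : Ctx} (h : WfCtx Γ) {n : ℕ} {A : Tm} (hA : Γ[n]? = some A) :
    ∃ i, Typed Γ (lift (n + 1) 0 A) (.sort i) := by
  induction Γ generalizing n with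
  | nil => cases hA
  | cons B Γ ih =>
    have h_wf := h
    rw [lift_succ_eq_ren]
    cases h with
    | cons hΓ hB =>
      cases n with
      | zero =>
        cases hA
        rw [lift_zero]
        exact ⟨_, hB.weaken h_wf⟩
      | succ n =>
        obtain ⟨i, hi⟩ := ih hΓ hA
        exact ⟨i, hi.weaken h_wf⟩

/-- Validity: the type of a well-typed term is well-formed. -/
theorem Typed.validity {Γ : Ctx} {t T : Tm} (h : Typed Γ t T) :
    ∃ i, Typed Γ T (.sort i) := by
  induction h using Typed.ind with
  | sort hΓ => exact ⟨_, .sort hΓ⟩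
  | var hΓ h_get => exact hΓ.lookup h_get
  | pi hA _ _ _ => exact ⟨_, .sort hA.wf⟩
  | lam hP _ _ _ => exact ⟨_, hP⟩
  | app _ hu ih _ =>
    obtain ⟨_, hP⟩ := ih
    obtain ⟨_, j, hB⟩ := hP.pi_inv
    exact ⟨j, hB.subst hu⟩
  | conv _ hB _ _ _ => exact ⟨_, hB⟩

/-- Subject reduction for one-step reduction. -/
theorem Typed.red {Γ : Ctx} {t t' T : Tm} (h : Typed Γ t T) (hr : Red t t') :
    Typed Γ t' T := by
  induction h using Typed.ind generalizing t' with
  | sort _ => cases hr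
  | var _ _ => cases hr
  | pi hA hB ih₁ ih₂ =>
    cases hr with
    | piDom _ hr =>
      exact .pi (ih₁ hr) (hB.conv_ctx hA (ih₁ hr) (.symm _ _ (.rel _ _ hr)))
    | piCod _ hr => exact .pi hA (ih₂ hr)
  | lam hP ht ih₁ ih₂ =>
    cases hr with
    | lamDom _ hr =>
      have hP' := ih₁ (.piDom _ hr)
      obtain ⟨⟨_, hA⟩, _⟩ := hP.pi_inv
      obtain ⟨⟨_, hA'⟩, _⟩ := hP'.pi_inv
      exact (Typed.lam hP' (ht.conv_ctx hA hA' (.symm _ _ (.rel _ _ hr)))).conv hP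
        (.symm _ _ (.rel _ _ (.piDom _ hr)))
    | lamBody _ hr => exact .lam hP (ih₂ hr)
  | @app Γ t u A B ht hu ih₁ ih₂ =>
    obtain ⟨i, hT⟩ := (ht.app hu).validity
    cases hr with
    | beta A₀ t₀ _ =>
      obtain ⟨B₀, ht₀, ⟨_, hP⟩, hc⟩ := ht.lam_inv
      obtain ⟨⟨_, hA₀⟩, _⟩ := hP.pi_inv
      obtain ⟨hcA, hcB⟩ := hc.pi_inj
      exact (ht₀.subst (hu.conv hA₀ (hcA.symm _ _))).conv hT (hcB.subst u)
    | appFun _ hr => exact .app (ih₁ hr) hu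
    | appArg _ hr =>
      exact (ht.app (ih₂ hr)).conv hT
        (((Par.refl B).subst hr.par).reds.conv.symm _ _)
  | conv _ hB hc ih _ => exact .conv (ih hr) hB hc

/-- Subject reduction. -/
theorem Typed.reds {Γ : Ctx} {t t' T : Tm} (h : Typed Γ t T) (hr : Reds t t') :
    Typed Γ t' T := by
  induction hr with
  | refl => exact h
  | tail _ hr ih => exact ih.red hr

/-! ### Correctness of the bidirectional system -/

mutual

theorem Infer.typed {Γ : Ctx} {t T : Tm} (hΓ : WfCtx Γ) : Infer Γ t T → Typed Γ t T
  | .sort => .sort hΓ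
  | .var h => .var hΓ h
  | .pi hA hB =>
    have hA := hA.typed hΓ
    .pi hA (hB.typed (.cons hΓ hA))
  | .lam hA ht =>
    have hA := hA.typed hΓ
    have ht := ht.typed (.cons hΓ hA)
    have ⟨_, hB⟩ := ht.validity
    .lam (.pi hA hB) ht
  | .app ht hu =>
    have ht := ht.typed hΓ
    have ⟨_, hP⟩ := ht.validity
    .app ht (hu.typed hΓ hP.pi_inv.1)

theorem Check.typed {Γ : Ctx} {t T : Tm} (hΓ : WfCtx Γ)
    (hT : ∃ i, Typed Γ T (.sort i)) : Check Γ t T → Typed Γ t T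
  | .check h hc =>
    have ⟨_, hT⟩ := hT
    .conv (h.typed hΓ) hT hc

theorem InferSort.typed {Γ : Ctx} {t T : Tm} (hΓ : WfCtx Γ) :
    InferSort Γ t T → Typed Γ t T
  | .inferSort h hr => .conv (h.typed hΓ) (.sort hΓ) hr.conv

theorem InferPi.typed {Γ : Ctx} {t T : Tm} (hΓ : WfCtx Γ) :
    InferPi Γ t T → Typed Γ t T
  | .inferPi h hr =>
    have h := h.typed hΓ
    have ⟨_, hT⟩ := h.validity
    .conv h (hT.reds hr) hr.conv

end

/-- **Correctness of bidirectional checking.** If `⊢ Γ`, `T` is well-formed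
and `Γ ⊢ t ◃ T`, then `Γ ⊢ t : T`. -/
theorem check_correct {Γ : Ctx} {t T : Tm} (hΓ : WfCtx Γ)
    (hT : ∃ i, Typed Γ T (.sort i)) (h : Check Γ t T) : Typed Γ t T :=
  h.typed hΓ hT

end CComega
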